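/- Let t ∈ (0,1) and let (x_n) be a sequence of natural numbers with 1 ≤ x_n ≤ n−1 and x_n/n → t as n → ∞. Then E(n,x_n)/FI_OBS(n,x_n) → 1/(2π) as n → ∞, where FI_OBS(n,x) = n³/(x·(n−x)) is the observed Fisher information of the binomial model at θ = x/n. -/

import Mathlib

open MeasureTheory Filter

/-- Two-sided evidential volume `V_E(n,x) = ∫₀¹ 2^n θ^x (1−θ)^{n−x} dθ`. -/
noncomputable def VE (n x : ℕ) : ℝ :=
  ∫ θ in (0:ℝ)..1, (2:ℝ) ^ n * θ ^ x * (1 - θ) ^ (n - x)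

/-- Evidential entropy (additive constant `k = 0`); `Real.log 0 = 0` encodes the
convention `0·log 0 = 0`. -/
noncomputable def SE (n x : ℕ) : ℝ :=
  x * Real.log (x / n) + ((n : ℝ) - x) * Real.log (((n : ℝ) - x) / n) + n * Real.log 2

/-- The evidence with `R = 1`, `C_V = 1/2`: `E = exp(2 S_E)/V_E²`. -/
noncomputable def Ev (n x : ℕ) : ℝ := Real.exp (2 * SE n x) / (VE n x) ^ 2

/-- Observed Fisher information of the binomial model at `θ = x/n`:
`FI_OBS(n,x) = n³/(x·(n−x))`. -/
noncomputable def FIobs (n x : ℕ) : ℝ := (n : ℝ) ^ 3 / ((x : ℝ) * ((n : ℝ) - x))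

lemma beta_nat (a b : ℕ) : ∫ θ in (0:ℝ)..1, θ ^ a * (1 - θ) ^ b
    = (a.factorial : ℝ) * b.factorial / (a + b + 1).factorial := by
  have h := Complex.Gamma_mul_Gamma_eq_betaIntegral (s := (a:ℂ) + 1) (t := (b:ℂ) + 1)
    (by simp; positivity) (by simp; positivity)
  have e : (a:ℂ) + 1 + (b + 1) = ((a + b + 1 : ℕ) : ℂ) + 1 := by push_cast; ring
  rw [e, Complex.Gamma_nat_eq_factorial, Complex.Gamma_nat_eq_factorial,
    Complex.Gamma_nat_eq_factorial] at h
  have h2 : Complex.betaIntegral ((a:ℂ) + 1) ((b:ℂ) + 1)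
      = ((∫ θ in (0:ℝ)..1, θ ^ a * (1 - θ) ^ b : ℝ) : ℂ) := by
    rw [Complex.betaIntegral, ← intervalIntegral.integral_ofReal]
    congr 1
    ext θ
    simp
  rw [h2] at h
  rw [eq_div_iff (by positivity), mul_comm]
  exact_mod_cast h.symm

lemma VE_eq (a b : ℕ) : VE (a + b) a
    = 2 ^ (a + b) * ((a.factorial : ℝ) * b.factorial / (a + b + 1).factorial) := by
  rw [VE, ← beta_nat, ← intervalIntegral.integral_const_mul]
  simp [mul_assoc]

lemma fact_eq (k : ℕ) (hk : 0 < k) :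
    (k.factorial : ℝ) ^ 2 * Real.exp k ^ 2 = Stirling.stirlingSeq k ^ 2 * (2 * k) * ((k:ℝ) ^ k) ^ 2 := by
  have hk' : (0:ℝ) < k := by exact_mod_cast hk
  have h1 : Real.sqrt (2 * k) ^ 2 = 2 * k := Real.sq_sqrt (by positivity)
  have h3 : Real.sqrt (2 * k) ≠ 0 := by positivity
  have h2 : Real.exp k = Real.exp 1 ^ k := by rw [← Real.exp_nat_mul]; simp
  rw [Stirling.stirlingSeq, h2, div_pow (k:ℝ), div_pow, mul_pow, h1]
  field_simp

lemma ratio_eq (a b : ℕ) (ha : 0 < a) (hb : 0 < b) : Ev (a + b) a / FIobs (a + b) a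
    = (1 + 1 / ((a + b : ℕ):ℝ)) ^ 2 * (Stirling.stirlingSeq (a + b) ^ 2 /
      (2 * Stirling.stirlingSeq a ^ 2 * Stirling.stirlingSeq b ^ 2)) := by
  have ha' : (0:ℝ) < a := by exact_mod_cast ha
  have hb' : (0:ℝ) < b := by exact_mod_cast hb
  have hS : Real.exp (SE (a + b) a)
      = (a:ℝ) ^ a * (b:ℝ) ^ b / ((a + b : ℕ) : ℝ) ^ (a + b) * 2 ^ (a + b) := by
    have e : ((a + b : ℕ) : ℝ) - a = b := by push_cast; ring
    have p : ∀ (k : ℕ) (y : ℝ), 0 < y → Real.exp (k * Real.log y) = y ^ k := by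
      intro k y hy
      rw [Real.exp_nat_mul, Real.exp_log hy]
    rw [SE, e, Real.exp_add, Real.exp_add, p _ _ (by positivity), p _ _ (by positivity),
      p _ _ (by positivity), div_pow, div_pow, pow_add ((a + b : ℕ) : ℝ)]
    field_simp
  have hSa : 0 < Stirling.stirlingSeq a := by
    obtain ⟨m, rfl⟩ := Nat.exists_eq_succ_of_ne_zero ha.ne'
    exact Stirling.stirlingSeq'_pos m
  have hSb : 0 < Stirling.stirlingSeq b := by
    obtain ⟨m, rfl⟩ := Nat.exists_eq_succ_of_ne_zero hb.ne'
    exact Stirling.stirlingSeq'_pos m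
  have fa := fact_eq a ha
  have fb := fact_eq b hb
  have fn := fact_eq (a + b) (by omega)
  have hE : Real.exp ((a + b : ℕ) : ℝ) = Real.exp a * Real.exp b := by
    rw [← Real.exp_add]; push_cast; rfl
  have e : ((a + b : ℕ) : ℝ) - a = b := by push_cast; ring
  have e2 : Real.exp (2 * SE (a + b) a) = Real.exp (SE (a + b) a) ^ 2 := by
    rw [← Real.exp_nat_mul]; simp
  rw [Ev, FIobs, e, e2, hS, VE_eq, Nat.factorial_succ, Nat.cast_mul]
  rw [hE] at fn
  have hN : (0:ℝ) < ((a + b : ℕ) : ℝ) := by positivity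
  have hN1 : ((a + b + 1 : ℕ) : ℝ) = ((a + b : ℕ) : ℝ) + 1 := by push_cast; ring
  rw [hN1]
  have hfa : (0:ℝ) < a.factorial := by positivity
  have hfb : (0:ℝ) < b.factorial := by positivity
  have hfn : (0:ℝ) < (a+b).factorial := by positivity
  have hpa : (0:ℝ) < (a:ℝ)^a := by positivity
  have hpb : (0:ℝ) < (b:ℝ)^b := by positivity
  have hpn : (0:ℝ) < ((a + b : ℕ) : ℝ)^(a+b) := by positivity
  have h2n : (0:ℝ) < (2:ℝ)^(a+b) := by positivity
  have hea := Real.exp_pos (a:ℝ)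
  have heb := Real.exp_pos (b:ℝ)
  generalize ((a + b : ℕ) : ℝ)^(a+b) = pn at *
  generalize (a:ℝ)^a = pa at *
  generalize (b:ℝ)^b = pb at *
  generalize (2:ℝ)^(a+b) = w at *
  generalize ((a + b : ℕ) : ℝ) = N at *
  generalize Real.exp (a:ℝ) = ea at *
  generalize Real.exp (b:ℝ) = eb at *
  generalize ((a+b).factorial : ℝ) = Fn at *
  generalize (a.factorial : ℝ) = Fa at *
  generalize (b.factorial : ℝ) = Fb at *
  generalize Stirling.stirlingSeq (a+b) = sn at *
  generalize Stirling.stirlingSeq a = sa at *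
  generalize Stirling.stirlingSeq b = sb at *
  generalize (a:ℝ) = A at *
  generalize (b:ℝ) = B at *
  have ra : sa ^ 2 = Fa ^ 2 * ea ^ 2 / (2 * A * pa ^ 2) := by
    rw [eq_div_iff (by positivity), fa]; ring
  have rb : sb ^ 2 = Fb ^ 2 * eb ^ 2 / (2 * B * pb ^ 2) := by
    rw [eq_div_iff (by positivity), fb]; ring
  have rn : sn ^ 2 = Fn ^ 2 * (ea * eb) ^ 2 / (2 * N * pn ^ 2) := by
    rw [eq_div_iff (by positivity), fn]; ring
  rw [ra, rb, rn]
  field_simp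

theorem evidence_fisher_ratio (t : ℝ) (ht : t ∈ Set.Ioo (0:ℝ) 1) (x : ℕ → ℕ)
    (hx : ∀ n, 2 ≤ n → 1 ≤ x n ∧ x n ≤ n - 1)
    (hlim : Tendsto (fun n : ℕ => (x n : ℝ) / n) atTop (nhds t)) :
    Tendsto (fun n : ℕ => Ev n (x n) / FIobs n (x n)) atTop
      (nhds (1 / (2 * Real.pi))) := by
  have hcast : Tendsto (fun n : ℕ => (n : ℝ)) atTop atTop := tendsto_natCast_atTop_atTop
  have hX : Tendsto x atTop atTop := by
    rw [← tendsto_natCast_atTop_iff (R := ℝ)]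
    refine (hlim.pos_mul_atTop ht.1 hcast).congr' ?_
    filter_upwards [eventually_ge_atTop 1] with n hn
    have : (0:ℝ) < n := by exact_mod_cast hn
    field_simp
  have hY : Tendsto (fun n => n - x n) atTop atTop := by
    rw [← tendsto_natCast_atTop_iff (R := ℝ)]
    have h1 : Tendsto (fun n : ℕ => 1 - (x n : ℝ) / n) atTop (nhds (1 - t)) := hlim.const_sub 1
    refine (h1.pos_mul_atTop (by linarith [ht.2]) hcast).congr' ?_
    filter_upwards [eventually_ge_atTop 2] with n hn
    have : (0:ℝ) < n := by exact_mod_cast (by omega : 0 < n)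
    have h := hx n hn
    rw [Nat.cast_sub (by omega)]
    field_simp
  have hs := Stirling.tendsto_stirlingSeq_sqrt_pi
  have hpi : Real.sqrt Real.pi ^ 2 = Real.pi := Real.sq_sqrt Real.pi_pos.le
  have hpos := Real.pi_pos
  have hone : Tendsto (fun n : ℕ => 1 + 1 / (n:ℝ)) atTop (nhds (1 + 0)) :=
    tendsto_one_div_atTop_nhds_zero_nat.const_add 1
  have key := (hone.pow 2).mul ((hs.pow 2).div
    ((((hs.comp hX).pow 2).const_mul 2).mul ((hs.comp hY).pow 2)) (by rw [hpi]; positivity))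
  rw [hpi] at key
  have hc : (1 + 0 : ℝ) ^ 2 * (Real.pi / (2 * Real.pi * Real.pi)) = 1 / (2 * Real.pi) := by
    field_simp; norm_num
  rw [hc] at key
  refine key.congr' ?_
  filter_upwards [eventually_ge_atTop 2] with n hn
  have h := hx n hn
  have r := ratio_eq (x n) (n - x n) (by omega) (by omega)
  rw [Nat.add_sub_cancel' (by omega)] at r
  rw [r]
  rfl
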